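/- Algebraic core of the main theorem (characterization): let κ₁, κ₂, r ∈ ℝ with r ≠ 0, and define ℓ(θ) := (1 - r*(κ₁*cos θ^2 + κ₂*sin θ^2))^2 + r^2*((κ₂ - κ₁)*sin θ*cos θ)^2. Then ℓ is a constant function of θ ∈ ℝ if and only if κ₁ = κ₂ or r*(κ₁ + κ₂) = 2. -/

import Mathlib

open Real

/-- The squared speed interpolates linearly in `cos² θ`, `sin² θ` between its values in the two
principal directions. -/
theorem squared_speed_eq (κ₁ κ₂ r θ : ℝ) :
    (1 - r * (κ₁ * cos θ ^ 2 + κ₂ * sin θ ^ 2)) ^ 2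
        + r ^ 2 * ((κ₂ - κ₁) * sin θ * cos θ) ^ 2
      = (1 - r * κ₁) ^ 2 * cos θ ^ 2 + (1 - r * κ₂) ^ 2 * sin θ ^ 2 := by
  simp only [mul_pow, sin_sq]
  ring

/-- Algebraic core of the main theorem (characterization): the squared speed
`ℓ(θ) = (1 - r κ_n(θ))² + r² τ_g(θ)²` is constant in `θ` if and only if the point is
umbilic (`κ₁ = κ₂`) or the mean curvature equals `1/r` (`r (κ₁ + κ₂) = 2`). -/
theorem isotropic_iff_umbilic_or_mean_curvature
    (κ₁ κ₂ r : ℝ) (hr : r ≠ 0) :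
    (∀ θ₁ θ₂ : ℝ,
        (1 - r * (κ₁ * cos θ₁ ^ 2 + κ₂ * sin θ₁ ^ 2)) ^ 2
            + r ^ 2 * ((κ₂ - κ₁) * sin θ₁ * cos θ₁) ^ 2
          = (1 - r * (κ₁ * cos θ₂ ^ 2 + κ₂ * sin θ₂ ^ 2)) ^ 2
            + r ^ 2 * ((κ₂ - κ₁) * sin θ₂ * cos θ₂) ^ 2)
      ↔ κ₁ = κ₂ ∨ r * (κ₁ + κ₂) = 2 := by
  simp only [squared_speed_eq]
  constructor
  · intro h
    have h₀ := h 0 (π / 2)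
    simp only [cos_zero, sin_zero, cos_pi_div_two, sin_pi_div_two] at h₀
    have key : r * ((κ₁ - κ₂) * (r * (κ₁ + κ₂) - 2)) = 0 := by linear_combination h₀
    rcases mul_eq_zero.mp ((mul_eq_zero.mp key).resolve_left hr) with h₁ | h₁
    · exact Or.inl (sub_eq_zero.mp h₁)
    · exact Or.inr (sub_eq_zero.mp h₁)
  · intro h θ₁ θ₂
    have hsq : (1 - r * κ₁) ^ 2 = (1 - r * κ₂) ^ 2 := by
      rcases h with rfl | h
      · rfl
      · linear_combination r * (κ₁ - κ₂) * h
    simp only [hsq, ← mul_add, cos_sq_add_sin_sq]
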